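/- arXiv:2010.07698 — 2 statements merged into one kernel-verified Lean document; each statement's English description precedes it below -/
import Mathlib

section
/- Fix an integer L ≥ 1 and define V : ℝ^L → ℝ by V(χ) = √( Σ_{l=1}^{L} (1 − (1 + χ_l)^{-2}) ). Then V is concave on the nonnegative orthant {χ ∈ ℝ^L : χ_l ≥ 0 for all l}, i.e., for all χ, χ' in the orthant and all t ∈ [0,1], V(tχ + (1−t)χ') ≥ t V(χ) + (1−t) V(χ'). -/
/-- Concavity of the dispersion penalty `V(χ) = √(Σ_l (1 − (1+χ_l)⁻²))`
on the nonnegative orthant. -/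
theorem stmt_6 (L : ℕ) (hL : 1 ≤ L) (χ χ' : Fin L → ℝ)
    (hχ : ∀ l, 0 ≤ χ l) (hχ' : ∀ l, 0 ≤ χ' l)
    (t : ℝ) (ht0 : 0 ≤ t) (ht1 : t ≤ 1) :
    t * Real.sqrt (∑ l, (1 - ((1 + χ l) ^ 2)⁻¹))
        + (1 - t) * Real.sqrt (∑ l, (1 - ((1 + χ' l) ^ 2)⁻¹))
      ≤ Real.sqrt (∑ l, (1 - ((1 + (t * χ l + (1 - t) * χ' l)) ^ 2)⁻¹)) := by
  have nn : ∀ x : Fin L → ℝ, (∀ l, 0 ≤ x l) → 0 ≤ ∑ l, (1 - ((1 + x l) ^ 2)⁻¹) := by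
    intro x hx
    refine Finset.sum_nonneg fun l _ => ?_
    have : ((1 + x l) ^ 2)⁻¹ ≤ 1 := inv_le_one_of_one_le₀ (by nlinarith [hx l])
    linarith
  have h1 := Real.strictConcaveOn_sqrt.concaveOn.2 (Set.mem_Ici.2 (nn χ hχ))
    (Set.mem_Ici.2 (nn χ' hχ')) ht0 (sub_nonneg.2 ht1) (by ring)
  simp only [smul_eq_mul] at h1
  refine h1.trans (Real.sqrt_le_sqrt ?_)
  rw [Finset.mul_sum, Finset.mul_sum, ← Finset.sum_add_distrib]
  refine Finset.sum_le_sum fun l _ => ?_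
  have h2 := (convexOn_zpow (𝕜 := ℝ) (-2)).2 (x := 1 + χ l) (y := 1 + χ' l)
    (Set.mem_Ioi.2 (by linarith [hχ l])) (Set.mem_Ioi.2 (by linarith [hχ' l]))
    ht0 (sub_nonneg.2 ht1) (by ring)
  have e : ∀ x : ℝ, x ^ (-2 : ℤ) = (x ^ 2)⁻¹ := fun x => by
    rw [zpow_neg]; norm_cast
  simp only [smul_eq_mul, e] at h2
  rw [show t * (1 + χ l) + (1 - t) * (1 + χ' l) = 1 + (t * χ l + (1 - t) * χ' l) by ring] at h2
  linarith
end

section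
/- Fix an integer L ≥ 1 and for χ ∈ ℝ^L set S(χ) = Σ_{l=1}^{L} (1 − (1 + χ_l)^{-2}). Let χ, χ⁰ ∈ ℝ^L have all entries nonnegative and suppose S(χ⁰) > 0. Then √(S(χ)) ≤ √(S(χ⁰)) + Σ_{l=1}^{L} [ (1 + χ⁰_l)^{-3} / √(S(χ⁰)) ] · (χ_l − χ⁰_l). -/
theorem scalar_aux (u v : ℝ) (hu : 0 < u) (hv : 0 < v) :
    1 - (u ^ 2)⁻¹ ≤ (1 - (v ^ 2)⁻¹) + 2 * ((v ^ 3)⁻¹ * (u - v)) := by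
  have h : (1 - (v ^ 2)⁻¹) + 2 * ((v ^ 3)⁻¹ * (u - v)) - (1 - (u ^ 2)⁻¹)
      = (u - v) ^ 2 * (2 * u + v) / (u ^ 2 * v ^ 3) := by
    field_simp
    ring
  have h2 : 0 ≤ (u - v) ^ 2 * (2 * u + v) / (u ^ 2 * v ^ 3) := by positivity
  linarith

/-- Taylor over-estimation inequality (33): with `S(χ) = Σ_l (1 − (1+χ_l)⁻²)`,
`√(S(χ)) ≤ √(S(χ⁰)) + Σ_l ((1+χ⁰_l)⁻³/√(S(χ⁰)))·(χ_l − χ⁰_l)` on the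
nonnegative orthant, provided `S(χ⁰) > 0`. -/
theorem stmt_7 (L : ℕ) (hL : 1 ≤ L) (χ χ₀ : Fin L → ℝ)
    (hχ : ∀ l, 0 ≤ χ l) (hχ₀ : ∀ l, 0 ≤ χ₀ l)
    (hS : 0 < ∑ l, (1 - ((1 + χ₀ l) ^ 2)⁻¹)) :
    Real.sqrt (∑ l, (1 - ((1 + χ l) ^ 2)⁻¹))
      ≤ Real.sqrt (∑ l, (1 - ((1 + χ₀ l) ^ 2)⁻¹))
        + ∑ l, (((1 + χ₀ l) ^ 3)⁻¹
            / Real.sqrt (∑ m, (1 - ((1 + χ₀ m) ^ 2)⁻¹))) * (χ l - χ₀ l) := by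
  have hsum : ∑ l, (1 - ((1 + χ l) ^ 2)⁻¹) ≤ ∑ l, (1 - ((1 + χ₀ l) ^ 2)⁻¹)
      + 2 * ∑ l, ((1 + χ₀ l) ^ 3)⁻¹ * (χ l - χ₀ l) := by
    rw [Finset.mul_sum, ← Finset.sum_add_distrib]
    apply Finset.sum_le_sum
    intro l _
    have h := scalar_aux (1 + χ l) (1 + χ₀ l) (by linarith [hχ l]) (by linarith [hχ₀ l])
    rwa [add_sub_add_left_eq_sub] at h
  have hnn : 0 ≤ ∑ l, (1 - ((1 + χ l) ^ 2)⁻¹) := by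
    apply Finset.sum_nonneg
    intro l _
    have : ((1 + χ l) ^ 2)⁻¹ ≤ 1 := inv_le_one_of_one_le₀ (by nlinarith [hχ l])
    linarith
  simp only [div_mul_eq_mul_div]
  rw [← Finset.sum_div]
  generalize ∑ l, (1 - ((1 + χ l) ^ 2)⁻¹) = A at *
  generalize ∑ l, (1 - ((1 + χ₀ l) ^ 2)⁻¹) = B at *
  generalize ∑ l, ((1 + χ₀ l) ^ 3)⁻¹ * (χ l - χ₀ l) = T at *
  have hb : 0 < Real.sqrt B := Real.sqrt_pos.mpr hS
  have hB := Real.sq_sqrt hS.le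
  have hA := Real.sq_sqrt hnn
  have : Real.sqrt B + T / Real.sqrt B = (B + T) / Real.sqrt B := by
    field_simp
    rw [hB]
  rw [this, le_div_iff₀ hb]
  nlinarith [sq_nonneg (Real.sqrt A - Real.sqrt B)]
end
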